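/- The perimeter of a stadium, i.e., the Minkowski sum in ℝ² of a closed ball of radius r > 0 and a segment of length 2a ≥ 0, equals 2π r + 4a. -/

import Mathlib

open MeasureTheory
open scoped Pointwise

namespace Stadium

/-- The plane. -/
abbrev E := EuclideanSpace ℝ (Fin 2)

/-- Circle parametrization, centre `(c,0)`, radius `r`. -/
noncomputable def arc (c r : ℝ) (t : ℝ) : E := !₂[c + r * Real.cos t, r * Real.sin t]

@[simp] lemma arc_zero (c r t : ℝ) : arc c r t 0 = c + r * Real.cos t := rfl
@[simp] lemma arc_one (c r t : ℝ) : arc c r t 1 = r * Real.sin t := rfl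

lemma dist_sq (p q : E) : dist p q ^ 2 = (p 0 - q 0) ^ 2 + (p 1 - q 1) ^ 2 := by
  rw [EuclideanSpace.dist_eq, Real.sq_sqrt (by positivity)]
  simp [Fin.sum_univ_two, Real.dist_eq, sq_abs]

lemma ext2 {p q : E} (h0 : p 0 = q 0) (h1 : p 1 = q 1) : p = q := by
  ext i; fin_cases i
  · exact h0
  · exact h1

lemma arc_lip (c : ℝ) {r : ℝ} (hr : 0 < r) : LipschitzWith (Real.toNNReal r) (arc c r) := by
  refine LipschitzWith.of_dist_le_mul fun s t => ?_
  rw [Real.coe_toNNReal r hr.le]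
  refine abs_le_of_sq_le_sq' ?_ (by positivity) |>.2
  rw [dist_sq, mul_pow, Real.dist_eq, sq_abs]
  have h := @Real.one_sub_sq_div_two_le_cos (s - t)
  rw [Real.cos_sub] at h
  have h1 := Real.sin_sq_add_cos_sq s
  have h2 := Real.sin_sq_add_cos_sq t
  simp only [arc_zero, arc_one]
  have : (c + r * Real.cos s - (c + r * Real.cos t)) ^ 2 + (r * Real.sin s - r * Real.sin t) ^ 2
      = r ^ 2 * (2 - 2 * (Real.cos s * Real.cos t + Real.sin s * Real.sin t)) := by
    linear_combination r ^ 2 * h1 + r ^ 2 * h2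
  rw [this]
  have : 0 ≤ r ^ 2 := by positivity
  nlinarith

lemma arc_inj (c : ℝ) {r : ℝ} (hr : 0 < r) {s t : ℝ} (h : arc c r s = arc c r t)
    (hst : |s - t| < 2 * Real.pi) : s = t := by
  have h0 : arc c r s 0 = arc c r t 0 := by rw [h]
  have h1 : arc c r s 1 = arc c r t 1 := by rw [h]
  simp only [arc_zero, arc_one] at h0 h1
  have h0' : Real.cos s = Real.cos t := mul_left_cancel₀ hr.ne' (by linarith)
  have h1' : Real.sin s = Real.sin t := mul_left_cancel₀ hr.ne' h1
  have : Real.cos (s - t) = 1 := by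
    rw [Real.cos_sub, h0', h1']
    linarith [Real.sin_sq_add_cos_sq t]
  rw [abs_lt] at hst
  have := (Real.cos_eq_one_iff_of_lt_of_lt hst.1 hst.2).1 this
  linarith

lemma arc_injOn (c : ℝ) {r : ℝ} (hr : 0 < r) {x y : ℝ} (h : y - x ≤ Real.pi) :
    Set.InjOn (arc c r) (Set.Ico x y) := by
  intro s hs t ht hst
  refine arc_inj c hr hst ?_
  rw [abs_lt]
  have := Real.pi_pos
  constructor <;> linarith [hs.1, hs.2, ht.1, ht.2]

lemma arc_meas (c : ℝ) {r : ℝ} (hr : 0 < r) {x y : ℝ} (h : y - x ≤ Real.pi) :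
    MeasurableSet (arc c r '' Set.Ico x y) :=
  measurableSet_Ico.image_of_continuousOn_injOn (arc_lip c hr).continuous.continuousOn
    (arc_injOn c hr h)

lemma arc_upper (c : ℝ) {r : ℝ} (hr : 0 < r) (x y : ℝ) :
    μH[1] (arc c r '' Set.Ioo x y) ≤ ENNReal.ofReal (r * (y - x)) := by
  refine ((arc_lip c hr).hausdorffMeasure_image_le zero_le_one _).trans ?_
  rw [hausdorffMeasure_real, Real.volume_Ioo, ENNReal.rpow_one, ENNReal.ofReal_mul hr.le]
  rfl

/-- Linear functional in direction orthogonal to angle `m`. -/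
noncomputable def proj (m : ℝ) (p : E) : ℝ := - Real.sin m * p 0 + Real.cos m * p 1

lemma proj_lip (m : ℝ) : LipschitzWith 1 (proj m) := by
  refine LipschitzWith.of_dist_le_mul fun p q => ?_
  rw [NNReal.coe_one, one_mul]
  refine abs_le_of_sq_le_sq' ?_ (by positivity) |>.2
  rw [dist_sq, Real.dist_eq, sq_abs]
  have h1 := Real.sin_sq_add_cos_sq m
  unfold proj
  have : (p 0 - q 0) ^ 2 + (p 1 - q 1) ^ 2 = (Real.sin m ^ 2 + Real.cos m ^ 2) *
    ((p 0 - q 0) ^ 2 + (p 1 - q 1) ^ 2) := by rw [h1, one_mul]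
  rw [this]
  nlinarith [sq_nonneg (Real.cos m * (p 0 - q 0) + Real.sin m * (p 1 - q 1))]

lemma arc_base (c : ℝ) {r : ℝ} (hr : 0 < r) {x y : ℝ} (hxy : x ≤ y) :
    ENNReal.ofReal (r * ((y - x) - (y - x) ^ 3 / 4)) ≤ μH[1] (arc c r '' Set.Ico x y) := by
  set m := (x + y) / 2 with hm
  have hp : ∀ t, proj m (arc c r t) = - Real.sin m * c + r * Real.sin (t - m) := by
    intro t
    simp only [proj, arc_zero, arc_one, Real.sin_sub]
    ring
  have h1 := (proj_lip m).hausdorffMeasure_image_le zero_le_one (arc c r '' Set.Ico x y)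
  rw [hausdorffMeasure_real, ENNReal.coe_one, ENNReal.one_rpow, one_mul, ← Set.image_comp] at h1
  refine le_trans ?_ h1
  have hc : Continuous (proj m ∘ arc c r) := (proj_lip m).continuous.comp (arc_lip c hr).continuous
  refine le_trans ?_ (measure_mono (intermediate_value_Ico hxy hc.continuousOn))
  rw [Real.volume_Ico]
  apply ENNReal.ofReal_le_ofReal
  simp only [Function.comp, hp]
  have e1 : y - m = (y - x) / 2 := by rw [hm]; ring
  have e2 : x - m = - ((y - x) / 2) := by rw [hm]; ring
  rw [e1, e2, Real.sin_neg]
  have hs : (y - x) / 2 - ((y - x) / 2) ^ 3 / 6 ≤ Real.sin ((y - x) / 2) := by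
    rcases hxy.eq_or_lt with h | h
    · subst h; simp
    · exact (Real.sin_gt_sub_cube (by linarith)).le
  have h3 : 0 ≤ (y - x) ^ 3 := pow_nonneg (by linarith) 3
  have : (y - x) - (y - x) ^ 3 / 4 ≤ 2 * Real.sin ((y - x) / 2) := by nlinarith
  nlinarith

lemma arc_iter (c : ℝ) {r : ℝ} (hr : 0 < r) (n : ℕ) : ∀ {x y : ℝ}, x ≤ y → y - x ≤ Real.pi →
    ENNReal.ofReal (r * ((y - x) - (y - x) ^ 3 / 4 * (1 / 4) ^ n)) ≤
      μH[1] (arc c r '' Set.Ico x y) := by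
  induction n with
  | zero => intro x y hxy _; simpa using arc_base c hr hxy
  | succ n ih =>
    intro x y hxy hpi
    set m := (x + y) / 2 with hm
    have hxm : x ≤ m := by linarith
    have hmy : m ≤ y := by linarith
    have hU : Set.Ico x y = Set.Ico x m ∪ Set.Ico m y := (Set.Ico_union_Ico_eq_Ico hxm hmy).symm
    have hd : Disjoint (arc c r '' Set.Ico x m) (arc c r '' Set.Ico m y) := by
      rw [Set.disjoint_left]
      rintro _ ⟨s, hs, rfl⟩ ⟨t, ht, hst⟩
      have := arc_injOn c hr hpi ⟨hxm.trans ht.1, ht.2⟩ ⟨hs.1, hs.2.trans_le hmy⟩ hst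
      linarith [hs.2, ht.1]
    rw [hU, Set.image_union, measure_union hd (arc_meas c hr (by linarith))]
    refine le_trans ?_ (add_le_add (ih hxm (by linarith)) (ih hmy (by linarith)))
    refine le_trans (ENNReal.ofReal_le_ofReal (le_of_eq ?_)) ENNReal.ofReal_add_le
    have e1 : y - m = (y - x) / 2 := by rw [hm]; ring
    have e2 : m - x = (y - x) / 2 := by rw [hm]; ring
    rw [e1, e2, pow_succ]
    ring

lemma arc_Ioo (c : ℝ) {r : ℝ} (hr : 0 < r) {x y : ℝ} (hxy : x < y) (hpi : y - x ≤ Real.pi) :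
    μH[1] (arc c r '' Set.Ioo x y) = ENNReal.ofReal (r * (y - x)) := by
  refine le_antisymm (arc_upper c hr x y) ?_
  haveI := Measure.nullSingletonClass_hausdorff E (d := 1) one_pos
  have h1 : μH[1] (arc c r '' Set.Ico x y) ≤ μH[1] (arc c r '' Set.Ioo x y) := by
    rw [← Set.Ioo_union_left hxy, Set.image_union, Set.image_singleton]
    refine (measure_union_le _ _).trans ?_
    simp
  refine le_trans ?_ h1
  refine le_of_tendsto' (x := Filter.atTop) (f := fun n : ℕ =>
    ENNReal.ofReal (r * ((y - x) - (y - x) ^ 3 / 4 * (1 / 4) ^ n))) ?_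
    (fun n => arc_iter c hr n hxy.le hpi)
  refine ENNReal.tendsto_ofReal ?_
  have := tendsto_pow_atTop_nhds_zero_of_lt_one (r := (1/4 : ℝ)) (by norm_num) (by norm_num)
  have := ((this.const_mul ((y - x) ^ 3 / 4)).const_sub (y - x)).const_mul r
  simpa using this

/-- Horizontal segments. -/
lemma seg (h a : ℝ) : μH[1] {p : E | p 0 ∈ Set.Icc (-a) a ∧ p 1 = h} = ENNReal.ofReal (2 * a) := by
  have hi : Isometry (fun t : ℝ => (!₂[t, h] : E)) := by
    refine Isometry.of_dist_eq fun s t => ?_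
    rw [EuclideanSpace.dist_eq]
    simp [Fin.sum_univ_two, Real.sqrt_sq_eq_abs, Real.dist_eq]
  have he : {p : E | p 0 ∈ Set.Icc (-a) a ∧ p 1 = h} = (fun t : ℝ => (!₂[t, h] : E)) '' Set.Icc (-a) a := by
    ext p
    constructor
    · rintro ⟨h0, h1⟩
      exact ⟨p 0, h0, ext2 rfl h1.symm⟩
    · rintro ⟨t, ht, rfl⟩
      exact ⟨ht, rfl⟩
  rw [he, hi.hausdorffMeasure_image (Or.inl zero_le_one), hausdorffMeasure_real, Real.volume_Icc]
  congr 1; ring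

lemma cos_arcsin_of {u v r : ℝ} (hr : 0 < r) (hu : 0 < u) (h : u ^ 2 + v ^ 2 = r ^ 2) :
    r * Real.cos (Real.arcsin (v / r)) = u ∧ r * Real.sin (Real.arcsin (v / r)) = v ∧
    Real.arcsin (v / r) ∈ Set.Ioo (-(Real.pi / 2)) (Real.pi / 2) := by
  have hv : |v| < r := abs_lt_of_sq_lt_sq (by nlinarith) hr.le
  rw [abs_lt] at hv
  have h1 : -1 < v / r := by rw [lt_div_iff₀ hr]; linarith
  have h2 : v / r < 1 := by rw [div_lt_iff₀ hr]; linarith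
  refine ⟨?_, ?_, Real.neg_pi_div_two_lt_arcsin.2 h1, Real.arcsin_lt_pi_div_two.2 h2⟩
  · rw [Real.cos_arcsin]
    have : 1 - (v / r) ^ 2 = (u / r) ^ 2 := by
      field_simp; linarith
    rw [this, Real.sqrt_sq (by positivity)]
    field_simp
  · rw [Real.sin_arcsin h1.le h2.le]
    field_simp

lemma right_eq {r : ℝ} (a : ℝ) (hr : 0 < r) :
    {p : E | a < p 0 ∧ (p 0 - a) ^ 2 + p 1 ^ 2 = r ^ 2} =
      arc a r '' Set.Ioo (-(Real.pi / 2)) (Real.pi / 2) := by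
  ext p
  constructor
  · rintro ⟨h0, h1⟩
    obtain ⟨e1, e2, e3⟩ := cos_arcsin_of hr (sub_pos.2 h0) h1
    refine ⟨_, e3, ext2 ?_ ?_⟩
    · rw [arc_zero, e1]; ring
    · rw [arc_one, e2]
  · rintro ⟨t, ht, rfl⟩
    have := Real.cos_pos_of_mem_Ioo ht
    refine ⟨?_, ?_⟩
    · rw [arc_zero]; nlinarith
    · rw [arc_zero, arc_one]
      linear_combination r ^ 2 * Real.sin_sq_add_cos_sq t

lemma left_eq {r : ℝ} (a : ℝ) (hr : 0 < r) :
    {p : E | p 0 < -a ∧ (p 0 + a) ^ 2 + p 1 ^ 2 = r ^ 2} =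
      arc (-a) r '' Set.Ioo (Real.pi / 2) (Real.pi + Real.pi / 2) := by
  ext p
  constructor
  · rintro ⟨h0, h1⟩
    obtain ⟨e1, e2, e3⟩ := cos_arcsin_of (u := -a - p 0) (v := p 1) hr (sub_pos.2 h0)
      (by rw [← h1]; ring)
    refine ⟨Real.pi - Real.arcsin (p 1 / r), ⟨by linarith [e3.2], by linarith [e3.1]⟩, ext2 ?_ ?_⟩
    · rw [arc_zero, Real.cos_pi_sub, mul_neg, e1]; ring
    · rw [arc_one, Real.sin_pi_sub, e2]
  · rintro ⟨t, ht, rfl⟩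
    have := Real.cos_neg_of_pi_div_two_lt_of_lt ht.1 ht.2
    refine ⟨?_, ?_⟩
    · rw [arc_zero]; nlinarith
    · rw [arc_zero, arc_one]
      linear_combination r ^ 2 * Real.sin_sq_add_cos_sq t

/-- Squared distance to the segment. -/
noncomputable def phi (a : ℝ) (p : E) : ℝ := (max (|p 0| - a) 0) ^ 2 + p 1 ^ 2

lemma phi_cont (a : ℝ) : Continuous (phi a) := by unfold phi; fun_prop

lemma stadium_eq {r a : ℝ} (hr : 0 < r) (ha : 0 ≤ a) :
    (Metric.closedBall (0 : E) r + {p : E | p 0 ∈ Set.Icc (-a) a ∧ p 1 = 0}) =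
      {p | phi a p ≤ r ^ 2} := by
  have hb : ∀ x : E, x ∈ Metric.closedBall (0 : E) r ↔ x 0 ^ 2 + x 1 ^ 2 ≤ r ^ 2 := by
    intro x
    rw [Metric.mem_closedBall, ← sq_le_sq₀ dist_nonneg hr.le, dist_sq]
    simp
  ext p
  rw [Set.mem_add]
  simp only [hb, Set.mem_setOf_eq, phi]
  constructor
  · rintro ⟨x, hx, y, ⟨hy, hy1⟩, rfl⟩
    simp only [PiLp.add_apply, hy1, add_zero]
    have : (max (|x 0 + y 0| - a) 0) ^ 2 ≤ x 0 ^ 2 := by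
      rw [← sq_abs (x 0)]
      refine pow_le_pow_left₀ (le_max_right _ _) (max_le ?_ (abs_nonneg _)) 2
      have := abs_add_le (x 0) (y 0)
      have := abs_le.2 hy
      linarith
    linarith
  · intro h
    rcases le_or_gt |p 0| a with h0 | h0
    · refine ⟨!₂[0, p 1], ?_, !₂[p 0, 0], ⟨abs_le.1 h0, rfl⟩, ext2 ?_ ?_⟩
      · rw [max_eq_right (by linarith)] at h
        simpa using h
      · simp
      · simp
    · rw [max_eq_left (by linarith)] at h
      rcases le_total 0 (p 0) with h2 | h2
      · rw [abs_of_nonneg h2] at h h0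
        refine ⟨!₂[p 0 - a, p 1], ?_, !₂[a, 0], ⟨⟨?_, ?_⟩, rfl⟩, ext2 ?_ ?_⟩
        · simpa using h
        · simp; linarith
        · simp
        · simp
        · simp
      · rw [abs_of_nonpos h2] at h h0
        refine ⟨!₂[p 0 + a, p 1], ?_, !₂[-a, 0], ⟨⟨?_, ?_⟩, rfl⟩, ext2 ?_ ?_⟩
        · simp; nlinarith
        · simp
        · simp; linarith
        · simp
        · simp

lemma phi_scale {r a t : ℝ} (hr : 0 < r) (ha : 0 ≤ a) (ht : 1 < t) {p : E} (hp : phi a p = r ^ 2) :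
    r ^ 2 < phi a (t • p) := by
  unfold phi at *
  simp only [PiLp.smul_apply, smul_eq_mul, abs_mul, abs_of_pos (zero_lt_one.trans ht)]
  have hm : t * max (|p 0| - a) 0 ≤ max (t * |p 0| - a) 0 := by
    rcases le_total (|p 0| - a) 0 with h | h
    · rw [max_eq_right h]; simp
    · rw [max_eq_left h]; refine le_trans ?_ (le_max_left _ _); nlinarith
  have h2 := pow_le_pow_left₀ (mul_nonneg (by linarith) (le_max_right _ _)) hm 2
  have ht2 : 1 < t ^ 2 := by nlinarith
  have : r ^ 2 < t ^ 2 * r ^ 2 := by nlinarith [pow_pos hr 2]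
  rw [mul_pow] at h2
  nlinarith

lemma frontier_stadium {r a : ℝ} (hr : 0 < r) (ha : 0 ≤ a) :
    frontier {p : E | phi a p ≤ r ^ 2} = {p | phi a p = r ^ 2} := by
  refine Set.Subset.antisymm (frontier_le_subset_eq (phi_cont a) continuous_const) ?_
  intro p hp
  rw [frontier_eq_closure_inter_closure]
  refine ⟨subset_closure (le_of_eq hp), ?_⟩
  have hc : Filter.Tendsto (fun t : ℝ => t • p) (nhdsWithin 1 (Set.Ioi 1)) (nhds p) := by
    have : Continuous (fun t : ℝ => t • p) := by fun_prop
    simpa using (this.tendsto 1).mono_left (nhdsWithin_le_nhds (s := Set.Ioi 1))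
  refine mem_closure_of_tendsto hc ?_
  filter_upwards [self_mem_nhdsWithin] with t ht
  exact not_le.2 (phi_scale hr ha ht hp)

lemma level_eq {r a : ℝ} (hr : 0 < r) (ha : 0 ≤ a) :
    {p : E | phi a p = r ^ 2} =
      (({p : E | p 0 ∈ Set.Icc (-a) a ∧ p 1 = r} ∪ {p : E | p 0 ∈ Set.Icc (-a) a ∧ p 1 = -r}) ∪
      {p : E | a < p 0 ∧ (p 0 - a) ^ 2 + p 1 ^ 2 = r ^ 2}) ∪
      {p : E | p 0 < -a ∧ (p 0 + a) ^ 2 + p 1 ^ 2 = r ^ 2} := by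
  ext p
  simp only [Set.mem_union, Set.mem_setOf_eq, phi, Set.mem_Icc]
  rcases lt_or_ge a (p 0) with h | h
  · rw [abs_of_pos (by linarith), max_eq_left (by linarith)]
    constructor
    · intro h1; exact Or.inl (Or.inr ⟨h, h1⟩)
    · rintro (((h1 | h1) | h1) | h1)
      · linarith [h1.1.2]
      · linarith [h1.1.2]
      · exact h1.2
      · linarith [h1.1]
  rcases lt_or_ge (p 0) (-a) with h' | h'
  · rw [abs_of_neg (by linarith), max_eq_left (by linarith)]
    constructor
    · intro h1; exact Or.inr ⟨h', by linarith⟩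
    · rintro (((h1 | h1) | h1) | h1)
      · linarith [h1.1.1]
      · linarith [h1.1.1]
      · linarith [h1.1]
      · linarith [h1.2]
  · rw [max_eq_right (by linarith [abs_le.2 ⟨h', h⟩])]
    constructor
    · intro h1
      have : p 1 ^ 2 = r ^ 2 := by linarith
      rcases sq_eq_sq_iff_eq_or_eq_neg.1 this with h2 | h2
      · exact Or.inl (Or.inl (Or.inl ⟨⟨h', h⟩, h2⟩))
      · exact Or.inl (Or.inl (Or.inr ⟨⟨h', h⟩, h2⟩))
    · rintro (((h1 | h1) | h1) | h1)
      · rw [h1.2]; ring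
      · rw [h1.2]; ring
      · linarith [h1.1]
      · linarith [h1.1]

end Stadium

open Stadium in
/-- The perimeter (1-dimensional Hausdorff measure of the boundary) of the stadium
`B(0,r) + [-a,a] × {0}` in the plane is `2 π r + 4 a`. -/
theorem stmt_7 {r a : ℝ} (hr : 0 < r) (ha : 0 ≤ a) :
    μH[1] (frontier
        (Metric.closedBall (0 : EuclideanSpace ℝ (Fin 2)) r +
          {p : EuclideanSpace ℝ (Fin 2) | p 0 ∈ Set.Icc (-a) a ∧ p 1 = 0})) =
      ENNReal.ofReal (2 * Real.pi * r + 4 * a) := by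
  rw [stadium_eq hr ha, frontier_stadium hr ha, level_eq hr ha]
  have m0 : Measurable (fun p : E => p 0) := by fun_prop
  have m1 : Measurable (fun p : E => p 1) := by fun_prop
  have hL : MeasurableSet {p : E | p 0 < -a ∧ (p 0 + a) ^ 2 + p 1 ^ 2 = r ^ 2} :=
    (measurableSet_lt m0 measurable_const).inter
      (measurableSet_eq_fun (by fun_prop) measurable_const)
  have hR : MeasurableSet {p : E | a < p 0 ∧ (p 0 - a) ^ 2 + p 1 ^ 2 = r ^ 2} :=
    (measurableSet_lt measurable_const m0).inter
      (measurableSet_eq_fun (by fun_prop) measurable_const)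
  have hB : MeasurableSet {p : E | p 0 ∈ Set.Icc (-a) a ∧ p 1 = -r} :=
    (m0 measurableSet_Icc).inter (measurableSet_eq_fun m1 measurable_const)
  rw [measure_union _ hL, measure_union _ hR, measure_union _ hB, seg, seg, right_eq a hr,
    left_eq a hr, arc_Ioo _ hr (by linarith [Real.pi_pos]) (by linarith [Real.pi_pos]),
    arc_Ioo _ hr (by linarith [Real.pi_pos]) (by linarith [Real.pi_pos])]
  · have hp := Real.pi_pos
    rw [← ENNReal.ofReal_add (by positivity) (by positivity),
      ← ENNReal.ofReal_add (by positivity) (mul_nonneg hr.le (by linarith)),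
      ← ENNReal.ofReal_add (add_nonneg (by positivity) (mul_nonneg hr.le (by linarith)))
        (mul_nonneg hr.le (by linarith))]
    congr 1; ring
  · rw [Set.disjoint_left]
    rintro p ⟨_, h1⟩ ⟨_, h2⟩
    linarith
  · rw [Set.disjoint_left]
    rintro p (⟨h1, _⟩ | ⟨h1, _⟩) ⟨h2, _⟩ <;> linarith [h1.2]
  · rw [Set.disjoint_left]
    rintro p ((⟨h1, _⟩ | ⟨h1, _⟩) | ⟨h1, _⟩) ⟨h2, _⟩
    · linarith [h1.1]
    · linarith [h1.1]
    · linarith
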